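/- κ* ≤ 𝔡(R^∃_0): the supremum over f of the dominating numbers of the infinitely-equal relations R^∃_f is at most the least cardinality of a family 𝒦 of partitions of ω into finite pieces of size at least 2 such that every infinite co-infinite X ⊆ ω completely misses infinitely many pieces of some partition in 𝒦. -/

import Mathlib

open Cardinal MeasureTheory Set Filter

/-- The dominating number of a relation `R ⊆ A × B`. -/
noncomputable def dNumber {A B : Type} (R : A → B → Prop) : Cardinal :=
  sInf { c : Cardinal | ∃ Y : Set B, #Y = c ∧ ∀ x : A, ∃ y ∈ Y, R x y }

/-- The infinitely-equal relation `R^∃_f` on `S_f = ∏ n, f n`. -/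
def REx (f : ℕ → ℕ) (η₀ η₁ : ∀ n, Fin (f n)) : Prop := {n | η₀ n = η₁ n}.Infinite

/-- `κ* = sup { 𝔡(R^∃_f) : f ∈ (ω \ {0})^ω }`. -/
noncomputable def kappaStar : Cardinal :=
  ⨆ f : {f : ℕ → ℕ // ∀ n, 0 < f n}, dNumber (REx f.1)

/-- `K` is a partition of `ω` into finite pieces each of size at least `2`. -/
def IsNicePartition (K : ℕ → Set ℕ) : Prop :=
  Pairwise (Function.onFun Disjoint K) ∧ (⋃ n, K n) = Set.univ ∧
    ∀ n, (K n).Finite ∧ 2 ≤ (K n).ncard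

/-- `𝔡(R^∃_0)`: the least cardinality of a family `𝒦` of partitions of `ω` into finite pieces
of size at least `2` such that every infinite co-infinite `X ⊆ ω` completely misses infinitely
many pieces of some partition in `𝒦`. -/
noncomputable def dRExZero : Cardinal :=
  sInf { c : Cardinal | ∃ 𝒦 : Set (ℕ → Set ℕ), #𝒦 = c ∧ (∀ K ∈ 𝒦, IsNicePartition K) ∧
    ∀ X : Set ℕ, X.Infinite → Xᶜ.Infinite →
      ∃ K ∈ 𝒦, {n | K n ∩ X = ∅}.Infinite }

/-- There is a decoder `D` such that every initial segment of every `η` has an even code beyond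
its length. -/
theorem exists_initialSegment_decoder :
    ∃ D : ℕ → ℕ → ℕ, ∀ (η : ℕ → ℕ) (n : ℕ), ∃ b, n < b ∧ Even b ∧ ∀ i ≤ n, D b i = η i := by
  refine ⟨fun b i => ((Encodable.decode (α := List ℕ) (b / 2).unpair.2).getD []).getD i 0,
    fun η n => ⟨2 * Nat.pair (n + 1) (Encodable.encode ((List.range (n + 1)).map η)), ?_,
      even_two_mul _, fun i hi => ?_⟩⟩
  · have := Nat.left_le_pair (n + 1) (Encodable.encode ((List.range (n + 1)).map η))
    omega
  · have h : i < n + 1 := by omega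
    simp [h]

/-- From a partition `K` one reads off a single function that equals `η` infinitely often
whenever infinitely many pieces of `K` are contained in a suitable set coding `η`. -/
theorem exists_guess_of_decoder {f : ℕ → ℕ} (hf : ∀ n, 0 < f n) (D : ℕ → ℕ → ℕ)
    (K : ℕ → Set ℕ) :
    ∃ y : ∀ n, Fin (f n), ∀ (η : ∀ n, Fin (f n)) (k c : ℕ), c ∈ K k →
      (∃ b ∈ K k, c < b) → (∀ k', c ∈ K k' → ∀ b ∈ K k', c < b → D b c = η c) → y c = η c := by
  have key : ∀ c, ∃ v : Fin (f c), ∀ (w : Fin (f c)) (k : ℕ), c ∈ K k →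
      (∃ b ∈ K k, c < b) → (∀ k', c ∈ K k' → ∀ b ∈ K k', c < b → D b c = w) → v = w := by
    intro c
    by_cases h : ∃ k, c ∈ K k ∧ ∃ b ∈ K k, c < b
    · obtain ⟨k, hk, b, hb, hcb⟩ := h
      refine ⟨⟨D b c % f c, Nat.mod_lt _ (hf c)⟩, fun w _ _ _ hw => Fin.ext ?_⟩
      simp only [hw k hk b hb hcb, Nat.mod_eq_of_lt w.isLt]
    · exact ⟨⟨0, hf c⟩, fun w k hk hb _ => absurd ⟨k, hk, hb⟩ h⟩
  choose y hy using key
  exact ⟨y, fun η k c => hy c (η c) k⟩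

/-- Every `η` is coded by an infinite co-infinite set in which each element determines the value
of `η` at all smaller elements. -/
theorem exists_coding_set {D : ℕ → ℕ → ℕ}
    (hD : ∀ (η : ℕ → ℕ) (n : ℕ), ∃ b, n < b ∧ Even b ∧ ∀ i ≤ n, D b i = η i) (η : ℕ → ℕ) :
    ∃ Z : Set ℕ, Z.Infinite ∧ Zᶜ.Infinite ∧ ∀ c ∈ Z, ∀ b ∈ Z, c < b → D b c = η c := by
  choose g hlt heven hval using hD η
  let s : ℕ → ℕ := fun n => g^[n] 0
  have hs : ∀ n, s (n + 1) = g (s n) := fun n => Function.iterate_succ_apply' g n 0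
  have hmono : StrictMono s := strictMono_nat_of_lt_succ fun n => by rw [hs]; exact hlt _
  refine ⟨range s, infinite_range_of_injective hmono.injective, ?_, ?_⟩
  · refine (infinite_range_of_injective (f := fun n : ℕ => 2 * n + 1)
      (fun a b h => by simpa using h)).mono ?_
    rintro _ ⟨n, rfl⟩ ⟨m, hm⟩
    have h : Even (s m) := by
      cases m with
      | zero => exact Even.zero
      | succ m => rw [hs]; exact heven _
    rw [hm] at h
    exact (Nat.not_even_iff_odd.2 (odd_two_mul_add_one n)) h
  · rintro _ ⟨i, rfl⟩ _ ⟨j, rfl⟩ hij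
    have hij' := hmono.lt_iff_lt.1 hij
    obtain ⟨j, rfl⟩ : ∃ m, j = m + 1 := ⟨j - 1, by omega⟩
    rw [hs]
    exact hval _ _ (hmono.monotone (by omega))

/-- For every infinite co-infinite `X`, some partition has infinitely many pieces missing `X`. -/
theorem exists_isNicePartition_infinite_disjoint {X : Set ℕ} (hX : X.Infinite)
    (hX' : Xᶜ.Infinite) : ∃ K, IsNicePartition K ∧ {n | K n ∩ X = ∅}.Infinite := by
  classical
  let h : ℕ → ℕ := fun x =>
    if x ∈ X then 2 * (Nat.count (· ∈ X) x / 2) + 1 else 2 * (Nat.count (· ∈ Xᶜ) x / 2)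
  have pair : ∀ (p : ℕ → Prop) [DecidablePred p], {x | p x}.Infinite → ∀ n,
      {x | p x ∧ Nat.count p x / 2 = n} = {Nat.nth p (2 * n), Nat.nth p (2 * n + 1)} := by
    intro p _ hp n
    ext x
    simp only [mem_ofPred_eq, mem_insert_iff, mem_singleton_iff]
    constructor
    · rintro ⟨hx, hn⟩
      rw [← Nat.nth_count hx, (Nat.nth_injective hp).eq_iff, (Nat.nth_injective hp).eq_iff]
      omega
    · rintro (rfl | rfl) <;>
      refine ⟨Nat.nth_mem_of_infinite hp _, ?_⟩ <;> rw [Nat.count_nth_of_infinite hp] <;> omega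
  have hodd : ∀ n, h ⁻¹' {2 * n + 1} = {x | x ∈ X ∧ Nat.count (· ∈ X) x / 2 = n} := by
    intro n
    ext x
    by_cases hx : x ∈ X <;> simp [h, hx]
    omega
  have heven : ∀ n, h ⁻¹' {2 * n} = {x | x ∈ Xᶜ ∧ Nat.count (· ∈ Xᶜ) x / 2 = n} := by
    intro n
    ext x
    by_cases hx : x ∈ X <;> simp [h, hx]
    omega
  have size : ∀ (p : ℕ → Prop) [DecidablePred p], {x | p x}.Infinite → ∀ n,
      {x | p x ∧ Nat.count p x / 2 = n}.Finite ∧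
        2 ≤ {x | p x ∧ Nat.count p x / 2 = n}.ncard := by
    intro p _ hp n
    rw [pair p hp n, ncard_pair ((Nat.nth_injective hp).ne (by omega))]
    exact ⟨toFinite _, le_rfl⟩
  refine ⟨fun n => h ⁻¹' {n}, ⟨?_, ?_, ?_⟩, ?_⟩
  · intro m n hmn
    exact Disjoint.preimage h (by simpa using hmn)
  · ext x
    simp
  · intro m
    obtain ⟨n, rfl | rfl⟩ := Nat.even_or_odd' m
    · simp only [heven n]
      exact size (· ∈ Xᶜ) hX' n
    · simp only [hodd n]
      exact size (· ∈ X) hX n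
  · refine (infinite_range_of_injective (f := fun n : ℕ => 2 * n)
      (fun a b h => by simpa using h)).mono ?_
    rintro _ ⟨n, rfl⟩
    simp only [mem_ofPred_eq, heven n]
    ext x
    simp +contextual

/-- A family of partitions witnessing `𝔡(R^∃_0)` yields a family of the same size that is
dominating for `R^∃_f`. -/
theorem dNumber_REx_le_mk {f : ℕ → ℕ} (hf : ∀ n, 0 < f n) {𝒦 : Set (ℕ → Set ℕ)}
    (hK : ∀ K ∈ 𝒦, IsNicePartition K)
    (hX : ∀ X : Set ℕ, X.Infinite → Xᶜ.Infinite → ∃ K ∈ 𝒦, {n | K n ∩ X = ∅}.Infinite) :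
    dNumber (REx f) ≤ #𝒦 := by
  obtain ⟨D, hD⟩ := exists_initialSegment_decoder
  choose y hy using fun K : ℕ → Set ℕ => exists_guess_of_decoder hf D K
  refine le_trans (csInf_le' ⟨y '' 𝒦, rfl, fun η => ?_⟩) (mk_image_le (f := y) (s := 𝒦))
  obtain ⟨Z, hZ, hZ', hcode⟩ := exists_coding_set hD (fun n => (η n : ℕ))
  obtain ⟨K, hKmem, hinf⟩ := hX Zᶜ hZ' (by rwa [compl_compl])
  refine ⟨y K, mem_image_of_mem y hKmem, ?_⟩
  obtain ⟨hdisj, -, hsize⟩ := hK K hKmem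
  have huniq : ∀ {a m n}, a ∈ K m → a ∈ K n → m = n := fun {a m n} hm hn => by
    by_contra hne
    exact disjoint_left.1 (hdisj hne) hm hn
  have hmin : ∀ k, ∃ c ∈ K k, ∃ b ∈ K k, c < b := by
    intro k
    obtain ⟨a, ha, b, hb, hab⟩ := (one_lt_ncard (hsize k).1).1 (hsize k).2
    rcases lt_or_gt_of_ne hab with h | h
    exacts [⟨a, ha, b, hb, h⟩, ⟨b, hb, a, ha, h⟩]
  choose c hc hcb using hmin
  have hinj : Function.Injective c := fun m n hmn => huniq (hc m) (hmn ▸ hc n)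
  refine (hinf.image hinj.injOn).mono ?_
  rintro _ ⟨k, hk, rfl⟩
  have hsub : K k ⊆ Z := by
    rwa [mem_ofPred_eq, ← disjoint_iff_inter_eq_empty, disjoint_compl_right_iff_subset] at hk
  refine (hy K η k (c k) (hc k) (hcb k) fun k' hk' b hb hlt => ?_).symm
  obtain rfl := huniq hk' (hc k)
  exact hcode _ (hsub hk') _ (hsub hb) hlt

/-- `κ* ≤ 𝔡(R^∃_0)`. -/
theorem kappaStar_le_dRExZero : kappaStar ≤ dRExZero := by
  refine le_csInf ⟨_, {K | IsNicePartition K}, rfl, fun _ h => h, fun X hX hX' => ?_⟩ ?_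
  · exact exists_isNicePartition_infinite_disjoint hX hX'
  · rintro _ ⟨𝒦, rfl, hK, hX⟩
    exact ciSup_le' fun f => dNumber_REx_le_mk f.2 hK hX
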